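/- arXiv:2401.15209 — 4 statements merged into one kernel-verified Lean document; each statement's English description precedes it below -/
import Mathlib

section
/- Let f : ℝ → ℝ be continuous and odd, and let F(t) = ∫₀ᵗ f(s) ds. Assume: (i) 0 < 2F(t) ≤ t·f(t) for all t ≠ 0; (ii) there exist t₀ > 0 and M > 0 such that F(t) ≤ M·|f(t)| whenever |t| ≥ t₀. Then for every ε > 0 there exists c > 0 such that F(t) ≥ c·|t|³ for all t with |t| ≥ ε. -/
open Real

/-- The primitive of an odd function vanishing at `0` is even. -/
lemma primitive_neg_of_odd {f : ℝ → ℝ} (hodd : ∀ t : ℝ, f (-t) = - f t) (t : ℝ) :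
    ∫ s in (0:ℝ)..(-t), f s = ∫ s in (0:ℝ)..t, f s := by
  have h := intervalIntegral.integral_comp_neg (a := 0) (b := t) f
  simp only [hodd, intervalIntegral.integral_neg, neg_zero] at h
  rw [intervalIntegral.integral_symm, ← h, neg_neg]

/-- A function with `F ≤ M F'` on `[a, ∞)` grows at least like `exp (t / M)`. -/
lemma mul_exp_le_of_le_mul_deriv {F f : ℝ → ℝ} {a M : ℝ} (hM : 0 < M)
    (hderiv : ∀ t, HasDerivAt F (f t) t) (hle : ∀ t, a ≤ t → F t ≤ M * f t)
    {t : ℝ} (ht : a ≤ t) : F a * exp (-a / M) * exp (t / M) ≤ F t := by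
  have hG (x : ℝ) : HasDerivAt (fun s => F s * exp (-s / M))
      (f x * exp (-x / M) + F x * (exp (-x / M) * (-1 / M))) x :=
    (hderiv x).mul (((hasDerivAt_id x).neg.div_const M).exp)
  have hmono : MonotoneOn (fun s => F s * exp (-s / M)) (Set.Ici a) := by
    refine monotoneOn_of_deriv_nonneg (convex_Ici a)
      (fun x _ => (hG x).continuousAt.continuousWithinAt)
      (fun x _ => (hG x).differentiableAt.differentiableWithinAt) fun x hx => ?_
    rw [interior_Ici] at hx
    rw [(hG x).deriv]
    have h : F x / M ≤ f x := by
      rw [div_le_iff₀ hM, mul_comm]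
      exact hle x (le_of_lt hx)
    calc 0 ≤ (f x - F x / M) * exp (-x / M) := mul_nonneg (sub_nonneg.2 h) (exp_pos _).le
      _ = _ := by ring
  calc F a * exp (-a / M) * exp (t / M) ≤ F t * exp (-t / M) * exp (t / M) :=
        mul_le_mul_of_nonneg_right (hmono Set.self_mem_Ici ht ht) (exp_pos _).le
    _ = F t := by rw [mul_assoc, ← exp_add]; simp [neg_div]

theorem stmt_1 (f F : ℝ → ℝ) (hf : Continuous f)
    (hodd : ∀ t : ℝ, f (-t) = - f t)
    (hF : ∀ t : ℝ, F t = ∫ s in (0:ℝ)..t, f s)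
    (hA1 : ∀ t : ℝ, t ≠ 0 → 0 < 2 * F t ∧ 2 * F t ≤ t * f t)
    (t₀ M : ℝ) (ht₀ : 0 < t₀) (hM : 0 < M)
    (hA2 : ∀ t : ℝ, t₀ ≤ |t| → F t ≤ M * |f t|) :
    ∀ ε : ℝ, 0 < ε → ∃ c : ℝ, 0 < c ∧ ∀ t : ℝ, ε ≤ |t| → c * |t| ^ 3 ≤ F t := by
  intro ε hε
  have hderiv (t : ℝ) : HasDerivAt F (f t) t := by
    rw [funext hF]
    exact hf.integral_hasStrictDerivAt 0 t |>.hasDerivAt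
  have hpos (t : ℝ) (ht : 0 < t) : 0 < F t := by linarith [(hA1 t ht.ne').1]
  have hfpos (t : ℝ) (ht : 0 < t) : 0 < f t := by
    have := hA1 t ht.ne'
    exact pos_of_mul_pos_right (this.1.trans_le this.2) ht.le
  have hmono : MonotoneOn F (Set.Ici 0) := by
    refine monotoneOn_of_deriv_nonneg (convex_Ici 0)
      (fun x _ => (hderiv x).continuousAt.continuousWithinAt)
      (fun x _ => (hderiv x).differentiableAt.differentiableWithinAt) fun x hx => ?_
    rw [interior_Ici] at hx
    rw [(hderiv x).deriv]
    exact (hfpos x hx).le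
  have hK : 0 < F t₀ * exp (-t₀ / M) := mul_pos (hpos t₀ ht₀) (exp_pos _)
  set K := F t₀ * exp (-t₀ / M) with hKdef
  refine ⟨min (F ε / t₀ ^ 3) (K / (6 * M ^ 3)),
    lt_min (div_pos (hpos ε hε) (by positivity)) (by positivity), fun t ht => ?_⟩
  have habs : F |t| = F t := by
    rcases abs_choice t with h | h
    · rw [h]
    · rw [h, hF, hF, primitive_neg_of_odd hodd]
  rw [← habs]
  generalize |t| = s at ht
  have hs : 0 < s := hε.trans_le ht
  rcases le_total s t₀ with h | h
  · calc _ ≤ F ε / t₀ ^ 3 * t₀ ^ 3 := by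
          have := hpos ε hε
          gcongr
          exact min_le_left _ _
      _ = F ε := by field_simp
      _ ≤ F s := hmono hε.le hs.le ht
  · have hexp := pow_div_factorial_le_exp (s / M) (by positivity) 3
    calc _ ≤ K / (6 * M ^ 3) * s ^ 3 := by
          gcongr
          exact min_le_right _ _
      _ = K * ((s / M) ^ 3 / (Nat.factorial 3 : ℕ)) := by
          simp only [Nat.factorial]
          push_cast
          field_simp
      _ ≤ K * exp (s / M) := by gcongr
      _ ≤ F s := by
          refine mul_exp_le_of_le_mul_deriv hM hderiv (fun x hx => ?_) h
          have hx0 := ht₀.trans_le hx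
          simpa [abs_of_pos (hfpos x hx0)] using hA2 x (by rwa [abs_of_pos hx0])
end

section
/- Let α₀ > 0, r > 2, and β ∈ ℝ with either β ≥ 0, or β < 0 and β² ≤ 8α₀(r − 2). Define f(t) = |t|^{r−2}·t·exp(α₀t² + β|t|) and F(t) = ∫₀ᵗ f(s) ds. Then 0 < 2F(t) ≤ t·f(t) for all t ≠ 0. -/
open Real

theorem monotoneOn_rpow_mul_exp {a b c : ℝ} (ha : 0 < a) (hc : 0 < c)
    (hb : 0 ≤ b ∨ (b < 0 ∧ b ^ 2 ≤ 8 * a * c)) :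
    MonotoneOn (fun t : ℝ => t ^ c * Real.exp (a * t ^ 2 + b * t)) (Set.Ici 0) := by
  have hderiv : ∀ t : ℝ, 0 < t → HasDerivAt (fun t : ℝ => t ^ c * Real.exp (a * t ^ 2 + b * t))
      (t ^ (c - 1) * Real.exp (a * t ^ 2 + b * t) * (2 * a * t ^ 2 + b * t + c)) t := by
    intro t ht
    have h1 : HasDerivAt (fun t : ℝ => a * t ^ 2 + b * t) (a * (2 * t) + b) t := by
      simpa using ((hasDerivAt_pow 2 t).const_mul a).fun_add ((hasDerivAt_id t).const_mul b)
    have h2 := (Real.hasDerivAt_rpow_const (p := c) (Or.inl ht.ne')).mul h1.exp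
    refine h2.congr_deriv ?_
    have h3 : t ^ c = t ^ (c - 1) * t := by
      rw [← Real.rpow_add_one ht.ne', sub_add_cancel]
    rw [h3]
    ring
  refine monotoneOn_of_deriv_nonneg (convex_Ici 0) ?_ ?_ ?_
  · exact ((continuous_id.rpow_const fun _ => Or.inr hc.le).mul (by fun_prop)).continuousOn
  · intro t ht
    rw [interior_Ici] at ht
    exact (hderiv t ht).differentiableAt.differentiableWithinAt
  · intro t ht
    rw [interior_Ici] at ht
    have ht : 0 < t := ht
    rw [(hderiv t ht).deriv]
    refine mul_nonneg (by positivity) ?_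
    rcases hb with hb | ⟨-, hb⟩
    · positivity
    · have : 0 ≤ 8 * a * (2 * a * t ^ 2 + b * t + c) := by
        nlinarith [sq_nonneg (4 * a * t + b)]
      exact nonneg_of_mul_nonneg_right this (by positivity)

theorem stmt_7 (α₀ r β : ℝ) (hα₀ : 0 < α₀) (hr : 2 < r)
    (hβ : 0 ≤ β ∨ (β < 0 ∧ β ^ 2 ≤ 8 * α₀ * (r - 2)))
    (f F : ℝ → ℝ)
    (hf : ∀ t : ℝ, f t = |t| ^ (r - 2) * t * Real.exp (α₀ * t ^ 2 + β * |t|))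
    (hF : ∀ t : ℝ, F t = ∫ s in (0:ℝ)..t, f s) :
    ∀ t : ℝ, t ≠ 0 → 0 < 2 * F t ∧ 2 * F t ≤ t * f t := by
  have hc : 0 < r - 2 := by linarith
  have hcont : Continuous f := by
    rw [funext hf]
    exact ((continuous_abs.rpow_const fun _ => Or.inr hc.le).mul continuous_id).mul (by fun_prop)
  have hodd : ∀ t, f (-t) = -f t := by
    intro t
    simp only [hf, abs_neg, neg_sq]
    ring
  have heven : ∀ t, F (-t) = F t := by
    intro t
    have h := intervalIntegral.integral_comp_neg (a := 0) (b := t) f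
    simp only [hodd, intervalIntegral.integral_neg, neg_zero] at h
    rw [hF, hF, intervalIntegral.integral_symm, ← h, neg_neg]
  have hpos : ∀ t : ℝ, 0 < t → 0 < 2 * F t ∧ 2 * F t ≤ t * f t := by
    intro t ht
    constructor
    · rw [hF]
      refine mul_pos two_pos (intervalIntegral.intervalIntegral_pos_of_pos_on
        (hcont.intervalIntegrable _ _) (fun s hs => ?_) ht)
      have hs0 : 0 < s := hs.1
      rw [hf]
      positivity
    · set g := t ^ (r - 2) * Real.exp (α₀ * t ^ 2 + β * t) with hg
      have hle : F t ≤ ∫ s in (0:ℝ)..t, s * g := by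
        rw [hF]
        refine intervalIntegral.integral_mono_on ht.le (hcont.intervalIntegrable _ _)
          (Continuous.intervalIntegrable (by fun_prop) _ _) fun s hs => ?_
        have hmono := monotoneOn_rpow_mul_exp hα₀ hc hβ hs.1 ht.le hs.2
        calc f s = s * (s ^ (r - 2) * Real.exp (α₀ * s ^ 2 + β * s)) := by
              rw [hf, abs_of_nonneg hs.1]
              ring
          _ ≤ s * g := mul_le_mul_of_nonneg_left hmono hs.1
      rw [intervalIntegral.integral_mul_const, integral_id] at hle
      have hft : t * f t = t ^ 2 * g := by
        rw [hf, abs_of_pos ht, hg]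
        ring
      rw [hft]
      linarith
  intro t ht
  rcases ht.lt_or_gt with h | h
  · have := hpos (-t) (neg_pos.mpr h)
    rwa [heven, hodd, neg_mul_neg] at this
  · exact hpos t h
end

section
/- Let α₀ > 0, r > 2, and β ∈ ℝ. Define f(t) = |t|^{r−2}·t·exp(α₀t² + β|t|) and F(t) = ∫₀ᵗ f(s) ds. Then there exist t₀ > 0 and M > 0 such that F(t) ≤ M·|f(t)| for all t with |t| ≥ t₀. -/
/-- If `f s ≤ f t * exp (s - t)` on `[0, t]`, then the integral of `f` over `[0, t]` is at most
`f t`. -/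
lemma integral_le_of_le_mul_exp_sub {f : ℝ → ℝ} {t : ℝ} (hf : Continuous f) (ht : 0 ≤ t)
    (hft : 0 ≤ f t) (hle : ∀ s ∈ Set.Icc 0 t, f s ≤ f t * Real.exp (s - t)) :
    ∫ s in (0:ℝ)..t, f s ≤ f t := by
  have hexp : ∫ s in (0:ℝ)..t, Real.exp (s - t) = 1 - Real.exp (-t) := by
    simp [intervalIntegral.integral_comp_sub_right (fun s => Real.exp s)]
  calc ∫ s in (0:ℝ)..t, f s
      ≤ ∫ s in (0:ℝ)..t, f t * Real.exp (s - t) :=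
        intervalIntegral.integral_mono_on ht (hf.intervalIntegrable _ _)
          (Continuous.intervalIntegrable (by fun_prop) _ _) hle
    _ = f t * (1 - Real.exp (-t)) := by rw [intervalIntegral.integral_const_mul, hexp]
    _ ≤ f t := mul_le_of_le_one_right hft (by linarith [Real.exp_pos (-t)])

lemma integral_zero_abs_of_odd {f : ℝ → ℝ} (hodd : ∀ s, f (-s) = -f s) (t : ℝ) :
    ∫ s in (0:ℝ)..|t|, f s = ∫ s in (0:ℝ)..t, f s := by
  rcases abs_choice t with h | h <;> rw [h]
  have := intervalIntegral.integral_comp_neg (a := 0) (b := t) f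
  simp only [hodd, intervalIntegral.integral_neg, neg_zero] at this
  rw [intervalIntegral.integral_symm, ← this, neg_neg]

theorem stmt_8 (α₀ r β : ℝ) (hα₀ : 0 < α₀) (hr : 2 < r)
    (f F : ℝ → ℝ)
    (hf : ∀ t : ℝ, f t = |t| ^ (r - 2) * t * Real.exp (α₀ * t ^ 2 + β * |t|))
    (hF : ∀ t : ℝ, F t = ∫ s in (0:ℝ)..t, f s) :
    ∃ t₀ > (0:ℝ), ∃ M > (0:ℝ), ∀ t : ℝ, t₀ ≤ |t| → F t ≤ M * |f t| := by
  have hcont : Continuous f := by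
    rw [funext hf]
    have : Continuous fun t : ℝ => |t| ^ (r - 2) :=
      continuous_abs.rpow_const fun _ => Or.inr (by linarith)
    fun_prop
  have hodd : ∀ s, f (-s) = -f s := fun s => by simp [hf]
  have habs : ∀ t, |f t| = f |t| := fun t => by
    simp [hf, abs_mul, abs_of_nonneg (Real.rpow_nonneg (abs_nonneg t) (r - 2))]
  refine ⟨(1 + |β|) / α₀, by positivity, 1, one_pos, fun t ht => ?_⟩
  rw [hF, ← integral_zero_abs_of_odd hodd, one_mul, habs]
  refine integral_le_of_le_mul_exp_sub hcont (abs_nonneg t) (habs t ▸ abs_nonneg _) ?_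
  generalize |t| = u at ht
  rintro s ⟨hs, hsu⟩
  have hu : 0 ≤ u := hs.trans hsu
  have hgrow : 1 ≤ α₀ * (u + s) + β := by
    rw [div_le_iff₀ hα₀] at ht
    nlinarith [neg_abs_le β, mul_nonneg hα₀.le hs]
  rw [hf, hf, abs_of_nonneg hs, abs_of_nonneg hu, mul_assoc _ (Real.exp _), ← Real.exp_add]
  have hexponent : α₀ * s ^ 2 + β * s ≤ α₀ * u ^ 2 + β * u + (s - u) := by
    nlinarith [mul_nonneg (sub_nonneg.2 hsu) (sub_nonneg.2 hgrow)]
  have hr' : 0 ≤ r - 2 := by linarith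
  gcongr
end

section
/- Let α₀ > 0, λ > 0, and β with 0 < β < 2√(2α₀), and let μ ≥ 2α₀λ/(2√(2α₀) − β). Define f(t) = (λ + μ|t|)·t·exp(α₀t² − β|t|) and F(t) = ∫₀ᵗ f(s) ds. Then 0 < 2F(t) ≤ t·f(t) for all t ≠ 0. -/
open Real

theorem nonneg_of_discrim_bound {a lam β μ : ℝ} (ha : 0 < a) (hlam : 0 < lam)
    (hβ₀ : 0 < β) (hμ₀ : 0 < μ) (hμ : a ^ 2 * lam ≤ μ * (2 * a - β)) (t : ℝ) :
    0 ≤ μ + (lam + μ * t) * (a ^ 2 * t - β) := by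
  have hsq : (β * μ + a ^ 2 * lam) ^ 2 ≤ (2 * a * μ) ^ 2 :=
    pow_le_pow_left₀ (by positivity) (by linarith) 2
  have hc : 0 < 4 * a ^ 2 * μ := by positivity
  refine nonneg_of_mul_nonneg_right (a := 4 * a ^ 2 * μ) ?_ hc
  nlinarith [sq_nonneg (2 * a ^ 2 * μ * t + a ^ 2 * lam - β * μ)]

theorem monotone_affine_mul_exp {α lam β μ : ℝ}
    (h : ∀ t, 0 ≤ μ + (lam + μ * t) * (2 * α * t - β)) :
    Monotone fun t : ℝ => (lam + μ * t) * exp (α * t ^ 2 - β * t) := by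
  have hd (t : ℝ) : HasDerivAt (fun t : ℝ => (lam + μ * t) * exp (α * t ^ 2 - β * t))
      ((μ + (lam + μ * t) * (2 * α * t - β)) * exp (α * t ^ 2 - β * t)) t := by
    have h₁ : HasDerivAt (fun t : ℝ => lam + μ * t) μ t := by
      simpa using ((hasDerivAt_id t).const_mul μ).const_add lam
    have h₂ : HasDerivAt (fun t : ℝ => α * t ^ 2 - β * t) (2 * α * t - β) t := by
      refine (((hasDerivAt_pow 2 t).const_mul α).sub
        ((hasDerivAt_id t).const_mul β)).congr_deriv ?_
      norm_num
      ring
    exact (h₁.mul h₂.exp).congr_deriv (by ring)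
  exact monotone_of_hasDerivAt_nonneg hd fun t => mul_nonneg (h t) (exp_pos _).le

theorem integral_zero_neg_of_odd {f : ℝ → ℝ} (hf : ∀ x, f (-x) = -f x) (t : ℝ) :
    ∫ s in (0:ℝ)..(-t), f s = ∫ s in (0:ℝ)..t, f s := by
  have h := intervalIntegral.integral_comp_neg (a := t) (b := 0) f
  simp only [hf, intervalIntegral.integral_neg, neg_zero] at h
  rw [← h, intervalIntegral.integral_symm, neg_neg]

theorem stmt_13 (α₀ lam β μ : ℝ) (hα₀ : 0 < α₀) (hlam : 0 < lam)
    (hβ₀ : 0 < β) (hβ : β < 2 * Real.sqrt (2 * α₀))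
    (hμ : 2 * α₀ * lam / (2 * Real.sqrt (2 * α₀) - β) ≤ μ)
    (f F : ℝ → ℝ)
    (hf : ∀ t : ℝ, f t = (lam + μ * |t|) * t * Real.exp (α₀ * t ^ 2 - β * |t|))
    (hF : ∀ t : ℝ, F t = ∫ s in (0:ℝ)..t, f s) :
    ∀ t : ℝ, t ≠ 0 → 0 < 2 * F t ∧ 2 * F t ≤ t * f t := by
  have hgap : 0 < 2 * √(2 * α₀) - β := by linarith
  have ha : 0 < √(2 * α₀) := by positivity
  have ha2 : √(2 * α₀) ^ 2 = 2 * α₀ := sq_sqrt (by positivity)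
  have hμ₀ : 0 < μ := lt_of_lt_of_le (by positivity) hμ
  have hbound : √(2 * α₀) ^ 2 * lam ≤ μ * (2 * √(2 * α₀) - β) := by
    rw [ha2]
    exact (div_le_iff₀ hgap).mp hμ
  have hmono : Monotone fun t : ℝ => (lam + μ * t) * exp (α₀ * t ^ 2 - β * t) := by
    refine monotone_affine_mul_exp fun t => ?_
    rw [← ha2]
    exact nonneg_of_discrim_bound ha hlam hβ₀ hμ₀ hbound t
  have hodd (x : ℝ) : f (-x) = -f x := by
    simp only [hf, abs_neg, neg_sq]
    ring
  have hcont : Continuous f := by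
    rw [funext hf]
    fun_prop
  have hpos (t : ℝ) (ht : 0 < t) : 0 < 2 * F t ∧ 2 * F t ≤ t * f t := by
    have hlow : 0 < F t := by
      rw [hF]
      refine intervalIntegral.intervalIntegral_pos_of_pos_on
        (hcont.intervalIntegrable 0 t) (fun x hx => ?_) ht
      have := hx.1
      rw [hf]
      positivity
    refine ⟨by linarith, ?_⟩
    have hup : F t ≤ ∫ s in (0:ℝ)..t, s * ((lam + μ * t) * exp (α₀ * t ^ 2 - β * t)) := by
      rw [hF]
      refine intervalIntegral.integral_mono_on ht.le (hcont.intervalIntegrable 0 t)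
        (Continuous.intervalIntegrable (by fun_prop) 0 t) fun x hx => ?_
      have h := mul_le_mul_of_nonneg_left (hmono hx.2) hx.1
      rw [hf, abs_of_nonneg hx.1]
      linarith
    rw [intervalIntegral.integral_mul_const, integral_id] at hup
    rw [hf, abs_of_pos ht]
    linarith
  intro t ht
  rcases ht.lt_or_gt with h | h
  · have := hpos (-t) (neg_pos.mpr h)
    rwa [hodd, neg_mul_neg, hF, integral_zero_neg_of_odd hodd, ← hF] at this
  · exact hpos t h
end
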